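/- arXiv:2012.14778 — 4 statements merged into one kernel-verified Lean document; each statement's English description precedes it below -/
import Mathlib

section
/- Let S be a positive semifield. Then S is refinable: for all a, b, c, d ∈ S with a + b = c + d, there exist x, y, z, t ∈ S such that x + y = a, z + t = b, x + z = c and y + t = d. -/
universe u

/-- The structure map of the free `S`-module (semimodule) monad on a left `S`-module `M`:
`a(φ) = Σ_{x ∈ supp φ} φ(x) • x`. -/
noncomputable def structMap (S : Type*) (M : Type*) [Semiring S] [AddCommMonoid M]
    [Module S M] (φ : M →₀ S) : M :=
  φ.sum fun x s => s • x

/-- The convex closure of a subset `A` of a left `S`-module: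
`conv(A) = { a(φ) | φ finitely supported, supp φ ⊆ A, Σ_x φ(x) = 1 }`. -/
def convClos (S : Type*) {M : Type*} [Semiring S] [AddCommMonoid M] [Module S M]
    (A : Set M) : Set M :=
  { m | ∃ φ : M →₀ S, ↑φ.support ⊆ A ∧ (φ.sum fun _ s => s) = 1 ∧ structMap S M φ = m }

/-- A subset of a left `S`-module is convex if it equals its convex closure. -/
def IsConvex (S : Type*) {M : Type*} [Semiring S] [AddCommMonoid M] [Module S M]
    (A : Set M) : Prop :=
  convClos S A = A

/-- `c(Φ)`: the set of finitely supported functions of the form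
`x ↦ Σ_{A ∈ supp Φ, u(A) = x} Φ(A)` for choice functions `u` with `u(A) ∈ A` on `supp Φ`. -/
noncomputable def choiceSet {S : Type*} {X : Type*} [Semiring S] (Φ : Set X →₀ S) :
    Set (X →₀ S) :=
  { φ | ∃ u : Set X → X, (∀ A ∈ Φ.support, u A ∈ A) ∧ φ = Finsupp.mapDomain u Φ }

/-- The canonical weak distributive law `δ_X(Φ) = conv(c(Φ))`,
the convex closure being taken in the module `X →₀ S`. -/
noncomputable def deltaLaw (S : Type*) {X : Type*} [Semiring S] (Φ : Set X →₀ S) :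
    Set (X →₀ S) :=
  convClos S (choiceSet Φ)

/-- `α_a(Φ) = { a(φ) | φ ∈ c(Φ) }`, where `a` is the structure map of the module `M`. -/
noncomputable def alphaMap (S : Type*) {M : Type*} [Semiring S] [AddCommMonoid M]
    [Module S M] (Φ : Set M →₀ S) : Set M :=
  structMap S M '' choiceSet Φ

/-- The Eilenberg–Moore style description of `δ_X(Φ)` via witnesses
`ψ` finitely supported on `{(A, x) | x ∈ A}` such that
`Φ(A) = Σ_{x ∈ A} ψ(A,x)` for all `A` and `φ(x) = Σ_{A ∋ x} ψ(A,x)` for all `x`. -/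
noncomputable def deltaEM (S : Type*) {X : Type*} [Semiring S] (Φ : Set X →₀ S) :
    Set (X →₀ S) :=
  { φ | ∃ ψ : (Set X × X) →₀ S,
      (∀ p ∈ ψ.support, p.2 ∈ p.1) ∧
      Finsupp.mapDomain Prod.fst ψ = Φ ∧
      Finsupp.mapDomain Prod.snd ψ = φ }

/-- The multiplication of the convex-powerset-of-semimodule monad:
`μ(𝒜) = ⋃_{Ω ∈ 𝒜} α(Ω)`. -/
noncomputable def muC (S : Type*) {M : Type*} [Semiring S] [AddCommMonoid M] [Module S M]
    (𝒜 : Set (Set M →₀ S)) : Set M :=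
  ⋃ Ω ∈ 𝒜, alphaMap S Ω

/-- The Kleisli extension `g♯` of `g : Y → C Z`:
`g♯(𝒜) = ⋃_{φ ∈ 𝒜} { Σ_{y ∈ supp φ} φ(y) • ψ_y | ψ_y ∈ g(y) }`. -/
noncomputable def kleisliExt {S : Type*} {Y Z : Type*} [Semiring S]
    (g : Y → Set (Z →₀ S)) (𝒜 : Set (Y →₀ S)) : Set (Z →₀ S) :=
  ⋃ φ ∈ 𝒜, { χ | ∃ ψ : Y → (Z →₀ S), (∀ y ∈ φ.support, ψ y ∈ g y) ∧
      χ = ∑ y ∈ φ.support, φ y • ψ y }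

/-- a positive semifield is refinable. -/
theorem positive_semifield_refinable (S : Type*) [DivisionSemiring S]
    (hpos : ∀ a b : S, a + b = 0 → a = 0 ∧ b = 0)
    (a b c d : S) (h : a + b = c + d) :
    ∃ x y z t : S, x + y = a ∧ z + t = b ∧ x + z = c ∧ y + t = d := by
  by_cases hs : a + b = 0
  · obtain ⟨rfl, rfl⟩ := hpos a b hs
    obtain ⟨rfl, rfl⟩ := hpos c d (h ▸ hs)
    exact ⟨0, 0, 0, 0, by simp⟩
  · have hs' : c + d ≠ 0 := h ▸ hs
    refine ⟨a * (a + b)⁻¹ * c, a * (a + b)⁻¹ * d, b * (a + b)⁻¹ * c, b * (a + b)⁻¹ * d,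
      ?_, ?_, ?_, ?_⟩
    · rw [← mul_add, h, inv_mul_cancel_right₀ hs']
    · rw [← mul_add, h, inv_mul_cancel_right₀ hs']
    · rw [← add_mul, ← add_mul, mul_inv_cancel₀ hs, one_mul]
    · rw [← add_mul, ← add_mul, mul_inv_cancel₀ hs, one_mul]
end

section
/- Let S be a positive semiring and X a set. For every A ⊆ X, δ_X(Δ_A) = { φ ∈ 𝕊X | supp φ ⊆ A and Σ_{x∈X} φ(x) = 1 }, where Δ_A : 𝒫X → S is the Dirac function at A (value 1 at A, value 0 elsewhere). -/
universe u

/-- Over a monoid in which sums vanish only trivially, pushing forward a finitely supported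
function does not shrink the image of its support. -/
theorem Finsupp.apply_mem_support_mapDomain_of_pos {M α β : Type*} [AddCommMonoid M]
    (hpos : ∀ a b : M, a + b = 0 → a = 0 ∧ b = 0) (f : α → β) (v : α →₀ M) {a : α}
    (ha : a ∈ v.support) : f a ∈ (Finsupp.mapDomain f v).support := by
  rw [Finsupp.mem_support_iff] at ha ⊢
  intro h
  rw [← Finsupp.single_add_erase a v, Finsupp.mapDomain_add, Finsupp.mapDomain_single,
    Finsupp.add_apply, Finsupp.single_eq_same] at h
  exact ha (hpos _ _ h).1

/-- Pushing forward a finitely supported function preserves its total mass. -/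
theorem Finsupp.sum_id_mapDomain {M α β : Type*} [AddCommMonoid M] (f : α → β) (v : α →₀ M) :
    ((Finsupp.mapDomain f v).sum fun _ s => s) = v.sum fun _ s => s :=
  Finsupp.sum_mapDomain_index (fun _ => rfl) (fun _ _ _ => rfl)

/-- for a positive semiring `S` and `A ⊆ X`,
`δ_X(Δ_A) = { φ ∈ 𝕊X | supp φ ⊆ A, Σ_x φ(x) = 1 }`. -/
theorem deltaEM_single {S : Type*} [Semiring S]
    (hpos : ∀ a b : S, a + b = 0 → a = 0 ∧ b = 0)
    {X : Type u} (A : Set X) :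
    deltaEM S (Finsupp.single A (1 : S)) =
      { φ : X →₀ S | ↑φ.support ⊆ A ∧ (φ.sum fun _ s => s) = 1 } := by
  classical
  ext φ
  constructor
  · rintro ⟨ψ, hmem, hfst, rfl⟩
    refine ⟨fun x hx => ?_, ?_⟩
    · obtain ⟨p, hp, rfl⟩ := Finset.mem_image.1 (Finsupp.mapDomain_support hx)
      have hpA := Finsupp.apply_mem_support_mapDomain_of_pos hpos Prod.fst ψ hp
      rw [hfst] at hpA
      have hA : p.1 = A := Finset.mem_singleton.1 (Finsupp.support_single_subset hpA)
      exact hA ▸ hmem p hp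
    · rw [Finsupp.sum_id_mapDomain, ← Finsupp.sum_id_mapDomain Prod.fst, hfst,
        Finsupp.sum_single_index rfl]
  · rintro ⟨hsupp, hsum⟩
    refine ⟨Finsupp.mapDomain (Prod.mk A) φ, fun p hp => ?_, ?_, ?_⟩
    · obtain ⟨x, hx, rfl⟩ := Finset.mem_image.1 (Finsupp.mapDomain_support hp)
      exact hsupp hx
    · rw [← Finsupp.mapDomain_comp, ← hsum, Finsupp.single_sum]
      rfl
    · rw [← Finsupp.mapDomain_comp]
      exact Finsupp.mapDomain_id
end

section
/- Let S be a positive semifield, X a left S-module with structure map a : 𝕊X → X, and Φ : 𝒫X → S finitely supported such that every A ∈ supp Φ is a convex subset of X. Then a''(conv_{𝕊X}(c(Φ))) = a''(c(Φ)), where conv_{𝕊X} is the convex closure in the module 𝕊X and a'' denotes direct image. -/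
universe u

theorem structMap_eq_linearCombination (S M : Type*) [Semiring S] [AddCommMonoid M]
    [Module S M] (φ : M →₀ S) : structMap S M φ = Finsupp.linearCombination S id φ :=
  rfl

theorem structMap_mapDomain {S M α : Type*} [Semiring S] [AddCommMonoid M] [Module S M]
    (u : α → M) (Φ : α →₀ S) :
    structMap S M (Finsupp.mapDomain u Φ) = Φ.sum fun a s => s • u a := by
  rw [structMap_eq_linearCombination, Finsupp.linearCombination_mapDomain]
  rfl

theorem subset_convClos (S : Type*) {M : Type*} [Semiring S] [AddCommMonoid M] [Module S M]
    (A : Set M) : A ⊆ convClos S A := by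
  intro m hm
  refine ⟨Finsupp.single m 1, fun x hx => ?_, by simp, by simp [structMap]⟩
  rw [Finset.mem_singleton.1 (Finsupp.support_single_subset hx)]
  exact hm

theorem IsConvex.sum_smul_mem {S M ι : Type*} [Semiring S] [AddCommMonoid M] [Module S M]
    {A : Set M} (hA : IsConvex S A) (s : Finset ι) (w : ι → S) (p : ι → M)
    (hw : ∑ i ∈ s, w i = 1) (hp : ∀ i ∈ s, p i ∈ A) : ∑ i ∈ s, w i • p i ∈ A := by
  classical
  rw [← hA]
  refine ⟨∑ i ∈ s, Finsupp.single (p i) (w i), fun x hx => ?_, ?_, ?_⟩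
  · obtain ⟨i, hi, hxi⟩ := Finset.mem_biUnion.1 (Finsupp.support_finsetSum hx)
    rw [Finset.mem_singleton.1 (Finsupp.support_single_subset hxi)]
    exact hp i hi
  · rw [← Finsupp.sum_finsetSum_index (fun _ => rfl) (fun _ _ _ => rfl), ← hw]
    simp
  · simp [structMap_eq_linearCombination]

/-- if every set in the support of `Φ : 𝒫X →₀ S` is convex, then
`a''(conv(c(Φ))) = a''(c(Φ))`. -/
theorem image_convClos_choiceSet_of_convex_support {S : Type*} [DivisionSemiring S]
    (hpos : ∀ a b : S, a + b = 0 → a = 0 ∧ b = 0)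
    {X : Type u} [AddCommMonoid X] [Module S X]
    (Φ : Set X →₀ S) (hΦ : ∀ A ∈ Φ.support, IsConvex S A) :
    structMap S X '' convClos S (choiceSet Φ) = structMap S X '' choiceSet Φ := by
  refine Set.Subset.antisymm ?_ (Set.image_mono (subset_convClos S _))
  rintro _ ⟨_, ⟨ψ, hψ, hsum, rfl⟩, rfl⟩
  have hchoice : ∀ χ ∈ ψ.support, ∃ v : Set X → X,
      (∀ A ∈ Φ.support, v A ∈ A) ∧ χ = Finsupp.mapDomain v Φ := fun χ hχ => hψ hχ
  choose! u hu hmap using hchoice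
  have hmem : ∀ A ∈ Φ.support,
      ∑ χ ∈ ψ.support, ((Φ A)⁻¹ * ψ χ * Φ A) • u χ A ∈ A := fun A hA =>
    (hΦ A hA).sum_smul_mem _ _ _
      (by
        rw [← Finset.sum_mul, ← Finset.mul_sum, show ∑ χ ∈ ψ.support, ψ χ = 1 from hsum,
          mul_one, inv_mul_cancel₀ (Finsupp.mem_support_iff.1 hA)])
      (fun χ hχ => hu χ hχ A hA)
  refine ⟨_, ⟨_, hmem, rfl⟩, ?_⟩
  rw [structMap_mapDomain, structMap_eq_linearCombination, structMap, map_finsuppSum]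
  simp only [map_smul, Finsupp.sum]
  have hterm : ∀ χ ∈ ψ.support, ψ χ • Finsupp.linearCombination S id χ =
      ∑ A ∈ Φ.support, ψ χ • Φ A • u χ A := fun χ hχ => by
    rw [← Finset.smul_sum]
    refine congrArg (ψ χ • ·) ((congrArg (structMap S X) (hmap χ hχ)).trans ?_)
    rw [structMap_mapDomain, Finsupp.sum]
  rw [Finset.sum_congr rfl hterm, Finset.sum_comm]
  refine Finset.sum_congr rfl fun A hA => ?_
  rw [Finset.smul_sum]
  refine Finset.sum_congr rfl fun χ _ => ?_
  rw [smul_smul, smul_smul, ← mul_assoc, ← mul_assoc,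
    mul_inv_cancel₀ (Finsupp.mem_support_iff.1 hA), one_mul]
end

section
/- Let S be a positive semifield, g : Y → C Z a function, and {𝒜_i}_{i∈I} any family of convex subsets of 𝕊Y. Then g♯(conv(⋃_i 𝒜_i)) = conv(⋃_i g♯(𝒜_i)), i.e., the Kleisli extension g♯ preserves arbitrary suprema of convex sets. -/
universe u

theorem sum_smul_mem_convClos {S M ι : Type*} [Semiring S] [AddCommMonoid M] [Module S M]
    {A : Set M} (t : Finset ι) (w : ι → S) (f : ι → M)
    (hf : ∀ i ∈ t, w i ≠ 0 → f i ∈ A) (hw : ∑ i ∈ t, w i = 1) :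
    ∑ i ∈ t, w i • f i ∈ convClos S A := by
  classical
  refine ⟨∑ i ∈ t, Finsupp.single (f i) (w i), ?_, ?_, ?_⟩
  · intro m hm
    obtain ⟨i, hi, hmi⟩ := Finset.mem_biUnion.mp (Finsupp.support_finsetSum hm)
    obtain ⟨rfl, hwi⟩ := Finsupp.mem_support_single _ _ _ |>.mp hmi
    exact hf i hi hwi
  · rw [← Finsupp.sum_finsetSum_index (fun _ => rfl) (fun _ _ _ => rfl)]
    simpa using hw
  · rw [structMap, ← Finsupp.sum_finsetSum_index (h := fun x s => s • x)
      (fun _ => zero_smul _ _) (fun _ _ _ => add_smul _ _ _)]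
    simp

theorem Finset.eq_zero_of_sum_eq_zero_of_positive {S ι : Type*} [AddCommMonoid S]
    (hpos : ∀ a b : S, a + b = 0 → a = 0 ∧ b = 0) {t : Finset ι} {f : ι → S}
    (h : ∑ i ∈ t, f i = 0) {i : ι} (hi : i ∈ t) : f i = 0 := by
  classical
  rw [← Finset.add_sum_erase t f hi] at h
  exact (hpos _ _ h).1

theorem sum_smul_mem_kleisliExt {S Y Z : Type*} [Semiring S] {g : Y → Set (Z →₀ S)}
    {𝒜 : Set (Y →₀ S)} {φ : Y →₀ S} (hφ : φ ∈ 𝒜) {ψ : Y → Z →₀ S}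
    (hψ : ∀ y ∈ φ.support, ψ y ∈ g y) :
    (φ.sum fun y s => s • ψ y) ∈ kleisliExt g 𝒜 :=
  Set.mem_biUnion hφ ⟨ψ, hψ, rfl⟩

theorem kleisliExt_convClos_subset {S Y Z : Type*} [DivisionSemiring S]
    (hpos : ∀ a b : S, a + b = 0 → a = 0 ∧ b = 0) (g : Y → Set (Z →₀ S))
    {I : Type*} (𝒜 : I → Set (Y →₀ S)) :
    kleisliExt g (convClos S (⋃ i, 𝒜 i)) ⊆ convClos S (⋃ i, kleisliExt g (𝒜 i)) := by
  intro χ hχ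
  obtain ⟨φ, ⟨p, hp, hp1, rfl⟩, ψ, hψ, rfl⟩ := Set.mem_iUnion₂.mp hχ
  have hsupp : ∀ a ∈ p.support, a.support ⊆ (structMap S (Y →₀ S) p).support := by
    intro a ha y hy
    rw [Finsupp.mem_support_iff] at ha hy ⊢
    intro h0
    rw [structMap, Finsupp.sum, Finsupp.finsetSum_apply] at h0
    exact mul_ne_zero ha hy (Finset.eq_zero_of_sum_eq_zero_of_positive hpos h0
      (Finsupp.mem_support_iff.mpr ha))
  have key : ∑ y ∈ (structMap S (Y →₀ S) p).support, (structMap S (Y →₀ S) p) y • ψ y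
      = ∑ a ∈ p.support, p a • a.sum fun y s => s • ψ y := by
    have hsum : ∀ a ∈ p.support, (p a • a.sum fun y s => s • ψ y)
        = ∑ y ∈ (structMap S (Y →₀ S) p).support, (p a * a y) • ψ y := by
      intro a ha
      rw [Finsupp.sum_of_support_subset _ (hsupp a ha) (fun y s => s • ψ y)
        (fun _ _ => zero_smul _ _), Finset.smul_sum]
      simp only [mul_smul]
    rw [Finset.sum_congr rfl hsum, Finset.sum_comm]
    refine Finset.sum_congr rfl fun y _ => ?_
    rw [← Finset.sum_smul]
    simp [structMap, Finsupp.sum, Finsupp.finsetSum_apply]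
  rw [key]
  refine sum_smul_mem_convClos _ _ _ (fun a ha _ => ?_) hp1
  obtain ⟨i, hi⟩ := Set.mem_iUnion.mp (hp ha)
  exact Set.mem_iUnion.mpr ⟨i, sum_smul_mem_kleisliExt hi fun y hy => hψ y (hsupp a ha hy)⟩

theorem convClos_kleisliExt_subset {S Y Z : Type*} [DivisionSemiring S]
    (hpos : ∀ a b : S, a + b = 0 → a = 0 ∧ b = 0) (g : Y → Set (Z →₀ S))
    (hg : ∀ y, IsConvex S (g y)) {I : Type*} (𝒜 : I → Set (Y →₀ S)) :
    convClos S (⋃ i, kleisliExt g (𝒜 i)) ⊆ kleisliExt g (convClos S (⋃ i, 𝒜 i)) := by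
  classical
  rintro _ ⟨p, hp, hp1, rfl⟩
  have hex : ∀ b : Z →₀ S, ∃ (φ : Y →₀ S) (ψ : Y → Z →₀ S), b ∈ p.support →
      φ ∈ (⋃ i, 𝒜 i) ∧ (∀ y ∈ φ.support, ψ y ∈ g y) ∧ b = φ.sum fun y s => s • ψ y := by
    intro b
    by_cases hb : b ∈ p.support
    · obtain ⟨i, hi⟩ := Set.mem_iUnion.mp (hp hb)
      obtain ⟨φ, hφ, ψ, hψ, h⟩ := Set.mem_iUnion₂.mp hi
      exact ⟨φ, ψ, fun _ => ⟨Set.mem_iUnion.mpr ⟨i, hφ⟩, hψ, h⟩⟩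
    · exact ⟨0, 0, fun h => absurd h hb⟩
  choose φ ψ h using hex
  set Φ : Y →₀ S := ∑ b ∈ p.support, p b • φ b with hΦ
  have hΦy : ∀ y, Φ y = ∑ b ∈ p.support, p b * φ b y := fun y => by
    simp [hΦ, Finsupp.finsetSum_apply]
  have hΦmem : Φ ∈ convClos S (⋃ i, 𝒜 i) :=
    sum_smul_mem_convClos _ _ _ (fun b hb _ => (h b hb).1) hp1
  have hsupp : ∀ b ∈ p.support, (φ b).support ⊆ Φ.support := by
    intro b hb y hy
    rw [Finsupp.mem_support_iff] at hy ⊢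
    intro h0
    rw [hΦy] at h0
    exact mul_ne_zero (Finsupp.mem_support_iff.mp hb) hy
      (Finset.eq_zero_of_sum_eq_zero_of_positive hpos h0 hb)
  have hψ : ∀ y ∈ Φ.support,
      ∑ b ∈ p.support, ((Φ y)⁻¹ * (p b * φ b y)) • ψ b y ∈ g y := by
    intro y hy
    rw [← hg y]
    refine sum_smul_mem_convClos _ _ _ (fun b hb hne => (h b hb).2.1 y ?_) ?_
    · exact Finsupp.mem_support_iff.mpr (right_ne_zero_of_mul (right_ne_zero_of_mul hne))
    · rw [← Finset.mul_sum, ← hΦy]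
      exact inv_mul_cancel₀ (Finsupp.mem_support_iff.mp hy)
  convert sum_smul_mem_kleisliExt hΦmem hψ using 1
  have hb : ∀ b ∈ p.support, p b • b = ∑ y ∈ Φ.support, (p b * φ b y) • ψ b y := by
    intro b hb
    refine (congrArg (p b • ·) (h b hb).2.2).trans ?_
    rw [Finsupp.sum_of_support_subset _ (hsupp b hb) (fun y s => s • ψ b y)
      (fun _ _ => zero_smul _ _), Finset.smul_sum]
    simp only [mul_smul]
  rw [structMap, Finsupp.sum, Finset.sum_congr rfl hb, Finset.sum_comm]
  refine Finset.sum_congr rfl fun y hy => ?_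
  dsimp only
  rw [Finset.smul_sum]
  refine Finset.sum_congr rfl fun b _ => ?_
  rw [← mul_smul, mul_inv_cancel_left₀ (Finsupp.mem_support_iff.mp hy)]

/-- the Kleisli extension `g♯` of `g : Y → C Z` preserves arbitrary
suprema of convex sets: `g♯(conv(⋃_i 𝒜_i)) = conv(⋃_i g♯(𝒜_i))`. -/
theorem kleisliExt_preserves_sup {S : Type*} [DivisionSemiring S]
    (hpos : ∀ a b : S, a + b = 0 → a = 0 ∧ b = 0)
    {Y Z : Type u} {I : Type u}
    (g : Y → Set (Z →₀ S)) (hg : ∀ y, IsConvex S (g y))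
    (𝒜 : I → Set (Y →₀ S)) (h𝒜 : ∀ i, IsConvex S (𝒜 i)) :
    kleisliExt g (convClos S (⋃ i, 𝒜 i)) = convClos S (⋃ i, kleisliExt g (𝒜 i)) :=
  (kleisliExt_convClos_subset hpos g 𝒜).antisymm (convClos_kleisliExt_subset hpos g hg 𝒜)
end
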